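/- Let A be a right artinian ring whose ext-quiver of mod A is acyclic, with primitive orthogonal idempotents {e_x} and simple modules S_x. Then End_A(e_x A) ≅ E_x = End_A(S_x) for each x, and for every A-module M of finite length, the multiplicity of S_x in a composition series of M equals dim_{E_x} Hom_A(e_x A, M). -/

import Mathlib

open MulOpposite

universe u

variable (A : Type u) [Ring A]

/-- The Jacobson radical of `A`, as a right ideal (= left ideal of `Aᵐᵒᵖ`).
Throughout, right `A`-modules are realized as left `Aᵐᵒᵖ`-modules. -/
noncomputable def Jrad : Ideal Aᵐᵒᵖ :=
  TwoSidedIdeal.asIdealOpposite (TwoSidedIdeal.jacobson (⊥ : TwoSidedIdeal A))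

/-- `A/J` as a right `A`-module. -/
noncomputable abbrev AoverJ := Aᵐᵒᵖ ⧸ Jrad A

/-- The simple right `A`-module `S_e = e·(A/J)` attached to an idempotent `e`. -/
noncomputable def Smod (e : A) : Submodule Aᵐᵒᵖ (AoverJ A) :=
  Submodule.span Aᵐᵒᵖ {Submodule.Quotient.mk (op e)}

/-- The projective right `A`-module `e·A` attached to an idempotent `e`. -/
def Pmod (e : A) : Submodule Aᵐᵒᵖ Aᵐᵒᵖ := Submodule.span Aᵐᵒᵖ {op e}

/-- A composition series of a module. -/
structure MCompSeries (R : Type u) [Ring R] (M : Type u) [AddCommGroup M] [Module R M] where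
  n : ℕ
  ser : Fin (n + 1) → Submodule R M
  strictMono : StrictMono ser
  bot : ser 0 = ⊥
  top : ser (Fin.last n) = ⊤
  simple : ∀ i : Fin n,
    IsSimpleModule R
      (↥(ser i.succ) ⧸ (Submodule.comap (ser i.succ).subtype (ser i.castSucc)))

/-- The `i`-th composition factor. -/
abbrev MCompSeries.factor {R M : Type u} [Ring R] [AddCommGroup M] [Module R M]
    (s : MCompSeries R M) (i : Fin s.n) :=
  ↥(s.ser i.succ) ⧸ (Submodule.comap (s.ser i.succ).subtype (s.ser i.castSucc))

/-- Nonvanishing of `Ext¹(T, S)` for modules: a non-split extension `0 → S → E → T → 0`. -/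
def MExtNonzero (R : Type u) [Ring R] (S T : Type u) [AddCommGroup S] [Module R S]
    [AddCommGroup T] [Module R T] : Prop :=
  ∃ (E : Type u) (_ : AddCommGroup E) (_ : Module R E) (f : S →ₗ[R] E) (g : E →ₗ[R] T),
    Function.Injective f ∧ Function.Surjective g ∧ LinearMap.range f = LinearMap.ker g ∧
      ¬ ∃ h : T →ₗ[R] E, g.comp h = LinearMap.id

/-- Arrows `[S] → [T]` of the ext-quiver of `mod A` (i.e. `Ext¹(T, S) ≠ 0`), on
representatives of the isomorphism classes of simple modules. -/
def MExtArrow (R : Type u) [Ring R] (S T : ModuleCat.{u} R) : Prop :=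
  IsSimpleModule R S ∧ IsSimpleModule R T ∧ MExtNonzero R S T

/-- The ext-quiver of `mod R` has no oriented cycles. -/
def MExtQuiverAcyclic (R : Type u) [Ring R] : Prop :=
  ∀ S T : ModuleCat.{u} R, Relation.TransGen (MExtArrow R) S T → ¬ Nonempty (S ≃ₗ[R] T)

/-- The underlying undirected graph of the ext-quiver of `mod R` is connected. -/
def MExtQuiverConnected (R : Type u) [Ring R] : Prop :=
  ∀ S T : ModuleCat.{u} R, IsSimpleModule R S → IsSimpleModule R T →
    Relation.ReflTransGen
      (fun (X Y : ModuleCat.{u} R) => (IsSimpleModule R X ∧ IsSimpleModule R Y) ∧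
        (MExtNonzero R X Y ∨ MExtNonzero R Y X ∨ Nonempty (X ≃ₗ[R] Y))) S T

/-- A complete set of pairwise orthogonal primitive idempotents of `A`. -/
structure IdempotentSystem (P : Type u) [Fintype P] (e : P → A) : Prop where
  idem : ∀ x, IsIdempotentElem (e x)
  orth : ∀ x y, x ≠ y → e x * e y = 0
  complete : ∑ x, e x = 1
  ne_zero : ∀ x, e x ≠ 0
  primitive : ∀ x, ∀ f g : A, IsIdempotentElem f → IsIdempotentElem g →
    f * g = 0 → g * f = 0 → f + g = e x → f = 0 ∨ g = 0

/-- `Hom_A(P, M)` is a right module over `End_A(P)`, by precomposition. -/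
instance endOppositeModule {R M N : Type u} [Ring R] [AddCommGroup M] [Module R M]
    [AddCommGroup N] [Module R N] : Module (Module.End R M)ᵐᵒᵖ (M →ₗ[R] N) where
  smul φ f := f.comp φ.unop
  one_smul f := LinearMap.comp_id f
  mul_smul φ ψ f := by
    show f.comp _ = (f.comp ψ.unop).comp φ.unop
    rw [unop_mul]; rfl
  smul_zero φ := rfl
  smul_add φ f g := rfl
  add_smul φ ψ f := by
    show f.comp (φ.unop + ψ.unop) = f.comp φ.unop + f.comp ψ.unop
    ext m; exact f.map_add _ _
  zero_smul f := by
    show f.comp 0 = 0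
    ext m; exact f.map_zero

section Helpers

open Submodule

variable {R : Type u} [Ring R]

/-- The basic construction of a non-split extension from the lattice of submodules. -/
lemma helper_ext {M : Type u} [AddCommGroup M] [Module R M]
    {N' N N2 N1 C : Submodule R M} (h21 : N2 ≤ N1)
    (hC : C ⊓ N = N') (hC2 : C ⊔ N = N2)
    (hno : ¬ ∃ D : Submodule R M, D ⊓ N = N' ∧ D ⊔ N = N1) :
    MExtNonzero R (↥N ⧸ N'.comap N.subtype) (↥N1 ⧸ N2.comap N1.subtype) := by
  have hN2 : N ≤ N2 := hC2 ▸ le_sup_right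
  have hCN2 : C ≤ N2 := hC2 ▸ le_sup_left
  have hN'C : N' ≤ C := hC ▸ inf_le_left
  have hN1 : N ≤ N1 := hN2.trans h21
  have hf : N'.comap N.subtype ≤ (C.comap N1.subtype).comap (inclusion hN1) := by
    intro x hx
    exact hN'C hx
  have hg : C.comap N1.subtype ≤ (N2.comap N1.subtype).comap LinearMap.id := by
    intro x hx
    exact hCN2 hx
  refine ⟨↥N1 ⧸ C.comap N1.subtype, inferInstance, inferInstance,
    mapQ _ _ (inclusion hN1) hf, mapQ _ _ LinearMap.id hg, ?_, ?_, ?_, ?_⟩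
  · rw [← LinearMap.ker_eq_bot, LinearMap.ker_eq_bot']
    intro m hm
    obtain ⟨m, rfl⟩ := mkQ_surjective _ m
    rw [mkQ_apply, mapQ_apply, Quotient.mk_eq_zero] at hm
    rw [mkQ_apply, Quotient.mk_eq_zero]
    have : (m : M) ∈ C ⊓ N := ⟨hm, m.2⟩
    rw [hC] at this
    exact this
  · intro t
    obtain ⟨t, rfl⟩ := mkQ_surjective _ t
    exact ⟨Submodule.Quotient.mk t, rfl⟩
  · ext y
    obtain ⟨y, rfl⟩ := mkQ_surjective _ y
    constructor
    · rintro ⟨m, hm⟩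
      obtain ⟨m, rfl⟩ := mkQ_surjective _ m
      rw [← hm, LinearMap.mem_ker, mkQ_apply, mapQ_apply, mapQ_apply, Quotient.mk_eq_zero]
      exact hN2 m.2
    · intro hy
      rw [LinearMap.mem_ker, mkQ_apply, mapQ_apply, Quotient.mk_eq_zero] at hy
      have hy' : (y : M) ∈ C ⊔ N := by rw [hC2]; exact hy
      obtain ⟨c, hc, n, hn, hcn⟩ := mem_sup.1 hy'
      refine ⟨Submodule.Quotient.mk ⟨n, hn⟩, ?_⟩
      rw [mkQ_apply, mapQ_apply, Submodule.Quotient.eq]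
      show n - (y : M) ∈ C
      rw [← hcn]
      simpa using hc
  · rintro ⟨h, hh⟩
    apply hno
    have hh' : ∀ t, mapQ _ _ LinearMap.id hg (h t) = t := fun t => LinearMap.congr_fun hh t
    refine ⟨((LinearMap.range h).comap (mkQ _)).map N1.subtype, ?_, ?_⟩
    · apply le_antisymm
      · rintro y ⟨⟨z, hz, rfl⟩, hyN⟩
        obtain ⟨t, ht⟩ := hz
        have h1 := hh' t
        rw [ht, mkQ_apply, mapQ_apply] at h1
        have h2 : t = 0 := by
          rw [← h1, Quotient.mk_eq_zero]
          exact hN2 hyN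
        rw [h2, map_zero, eq_comm, mkQ_apply, Quotient.mk_eq_zero] at ht
        rw [← hC]
        exact ⟨ht, hyN⟩
      · intro y hy
        have hyC := hN'C hy
        rw [← hC] at hy
        refine ⟨⟨⟨y, hN1 hy.2⟩, ?_, rfl⟩, hy.2⟩
        refine ⟨0, ?_⟩
        rw [map_zero, eq_comm, mkQ_apply, Quotient.mk_eq_zero]
        exact hyC
    · apply le_antisymm
      · refine sup_le ?_ hN1
        rintro _ ⟨z, -, rfl⟩
        exact z.2
      · intro y hy
        obtain ⟨d, hd⟩ := mkQ_surjective _ (h (Submodule.Quotient.mk ⟨y, hy⟩))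
        have h1 := hh' (Submodule.Quotient.mk ⟨y, hy⟩)
        rw [← hd, mkQ_apply, mapQ_apply, eq_comm, Submodule.Quotient.eq] at h1
        have h2 : y - (d : M) ∈ C ⊔ N := by rw [hC2]; exact h1
        obtain ⟨c, hc, n, hn, hcn⟩ := mem_sup.1 h2
        have hcN1 : c ∈ N1 := h21 (hCN2 hc)
        have hy3 : y = ((d : M) + c) + n := by
          rw [add_assoc, hcn]; abel
        rw [hy3]
        refine add_mem_sup ?_ hn
        refine add_mem ⟨d, ⟨_, hd.symm⟩, rfl⟩ ⟨⟨c, hcN1⟩, ⟨0, ?_⟩, rfl⟩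
        rw [map_zero, eq_comm, mkQ_apply, Quotient.mk_eq_zero]
        exact hc

variable {P : Type u} [AddCommGroup P] [Module R P]

lemma helper_path [IsNoetherian R P] [IsArtinian R P] (Q : Submodule R P) (hQ' : Q ≠ ⊤)
    (hQ : ∀ N : Submodule R P, N ≠ ⊤ → N ≤ Q) (N' : Submodule R P) :
    ∀ N, N' ⋖ N → N ≠ ⊤ →
      Relation.TransGen (MExtArrow R) (ModuleCat.of R (↥N ⧸ N'.comap N.subtype))
        (ModuleCat.of R (↥(⊤ : Submodule R P) ⧸ Q.comap (⊤ : Submodule R P).subtype)) := by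
  induction N' using WellFoundedGT.induction with
  | ind N' ih =>
  intro N hcov hN
  let s : Set (Submodule R P) :=
    {X | N ≤ X ∧ ¬ ∃ D : Submodule R P, D ⊓ N = N' ∧ D ⊔ N = X}
  have hs : s.Nonempty := by
    refine ⟨⊤, le_top, ?_⟩
    rintro ⟨D, hD1, hD2⟩
    have hD : D = ⊤ := by
      by_contra hD
      exact hQ' (top_le_iff.1 (hD2 ▸ sup_le (hQ D hD) (hQ N hN)))
    rw [hD, top_inf_eq] at hD1
    exact hcov.lt.ne hD1.symm
  obtain ⟨N1, ⟨hNN1, hno⟩, hmin⟩ := (wellFounded_lt (α := Submodule R P)).has_min s hs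
  have hlt : N < N1 := by
    refine lt_of_le_of_ne hNN1 ?_
    rintro rfl
    exact hno ⟨N', inf_eq_left.2 hcov.le, sup_eq_right.2 hcov.le⟩
  obtain ⟨N2, hNN2, hN2⟩ := exists_le_covBy_of_lt hlt
  have hC : ∃ D : Submodule R P, D ⊓ N = N' ∧ D ⊔ N = N2 := by
    by_contra hcon
    exact hmin N2 ⟨hNN2, hcon⟩ hN2.lt
  obtain ⟨C, hC1, hC2⟩ := hC
  have harr : MExtArrow R (ModuleCat.of R (↥N ⧸ N'.comap N.subtype))
      (ModuleCat.of R (↥N1 ⧸ N2.comap N1.subtype)) :=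
    ⟨(covBy_iff_quot_is_simple hcov.le).1 hcov, (covBy_iff_quot_is_simple hN2.le).1 hN2,
      helper_ext hN2.le hC1 hC2 hno⟩
  by_cases hN1 : N1 = ⊤
  · subst hN1
    have : N2 = Q := (covBy_top_iff.1 hN2).le_iff_eq hQ' |>.1 (hQ _ hN2.lt.ne) |>.symm
    subst this
    exact .single harr
  · exact .head harr (ih N2 (hcov.lt.trans_le hNN2) N1 hN2 hN1)

lemma helper_unit [IsNoetherian R P] [IsArtinian R P] (Q : Submodule R P) (hQ' : Q ≠ ⊤)
    (hQ : ∀ N : Submodule R P, N ≠ ⊤ → N ≤ Q) (hac : MExtQuiverAcyclic R)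
    (φ : Module.End R P) (hφ : φ ≠ 0) : Function.Bijective φ := by
  have hsurj : Function.Surjective φ := by
    rw [← LinearMap.range_eq_top]
    by_contra hr
    have hcoat : IsCoatom Q := ⟨hQ', fun N hN => by
      by_contra h
      exact hN.not_ge (hQ N h)⟩
    have hker : LinearMap.ker φ ≤ Q := hQ _ fun h => hφ (LinearMap.ker_eq_top.1 h)
    let N := LinearMap.range φ
    let N' := Q.map φ
    have hle : N' ≤ N := LinearMap.map_le_range
    let ψ : P →ₗ[R] ↥N ⧸ N'.comap N.subtype := (mkQ _).comp φ.rangeRestrict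
    have hψ : Function.Surjective ψ := (mkQ_surjective _).comp φ.surjective_rangeRestrict
    have hkψ : LinearMap.ker ψ = Q := by
      ext p
      have : p ∈ LinearMap.ker ψ ↔ φ p ∈ N' := by
        rw [LinearMap.mem_ker, LinearMap.comp_apply, mkQ_apply, Quotient.mk_eq_zero]
        rfl
      rw [this]
      constructor
      · rintro ⟨q, hq, hqp⟩
        have : p - q ∈ LinearMap.ker φ := by simp [hqp]
        have h2 := add_mem (hker this) hq
        simpa using h2
      · exact fun h => ⟨p, h, rfl⟩
    let i : (P ⧸ Q) ≃ₗ[R] (↥N ⧸ N'.comap N.subtype) :=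
      (quotEquivOfEq _ _ hkψ.symm).trans (ψ.quotKerEquivOfSurjective hψ)
    have hs : IsSimpleModule R (P ⧸ Q) := isSimpleModule_iff_isCoatom.2 hcoat
    have hcov : N' ⋖ N := (covBy_iff_quot_is_simple hle).2 (IsSimpleModule.congr i.symm)
    let ξ : ↥(⊤ : Submodule R P) →ₗ[R] P ⧸ Q := (mkQ Q).comp (⊤ : Submodule R P).subtype
    have hξ : Function.Surjective ξ :=
      (mkQ_surjective _).comp fun p => ⟨⟨p, trivial⟩, rfl⟩
    have hkξ : LinearMap.ker ξ = Q.comap (⊤ : Submodule R P).subtype := by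
      rw [LinearMap.ker_comp, ker_mkQ]
    let j : (↥(⊤ : Submodule R P) ⧸ Q.comap (⊤ : Submodule R P).subtype) ≃ₗ[R] (P ⧸ Q) :=
      (quotEquivOfEq _ _ hkξ.symm).trans (ξ.quotKerEquivOfSurjective hξ)
    exact hac _ _ (helper_path Q hQ' hQ N' N hcov hr) ⟨(j.trans i).symm⟩
  exact IsNoetherian.bijective_of_surjective_endomorphism φ hsurj

lemma helper_endIso [Module.Projective R P] (Q : Submodule R P) (hQ' : Q ≠ ⊤)
    (hQ : ∀ N : Submodule R P, N ≠ ⊤ → N ≤ Q)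
    (hbij : ∀ φ : Module.End R P, φ ≠ 0 → Function.Bijective φ) :
    Nonempty (Module.End R P ≃+* Module.End R (P ⧸ Q)) := by
  have hst : ∀ φ : Module.End R P, Q ≤ Q.comap φ := by
    intro φ
    by_cases hφ : φ = 0
    · subst hφ; intro q _; simp
    · rw [← map_le_iff_le_comap]
      apply hQ
      intro h
      apply hQ'
      rw [← comap_map_eq_of_injective (hbij φ hφ).1 Q, h, comap_top]
  let F : Module.End R P →+* Module.End R (P ⧸ Q) :=
    { toFun := fun φ => Q.mapQ Q φ (hst φ)
      map_one' := by ext; rfl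
      map_zero' := by ext; rfl
      map_mul' := fun _ _ => by ext; rfl
      map_add' := fun _ _ => by ext; rfl }
  refine ⟨RingEquiv.ofBijective F ⟨?_, ?_⟩⟩
  · rw [injective_iff_map_eq_zero]
    intro φ hφ
    by_contra hne
    apply hQ'
    rw [eq_top_iff]
    rintro p -
    obtain ⟨q, rfl⟩ := (hbij φ hne).2 p
    have := LinearMap.congr_fun hφ (Submodule.Quotient.mk q)
    exact (Quotient.mk_eq_zero Q).1 this
  · intro χ
    obtain ⟨φ, hφ⟩ := Module.projective_lifting_property (mkQ Q) (χ.comp (mkQ Q))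
      (mkQ_surjective Q)
    exact ⟨φ, by ext p; exact LinearMap.congr_fun hφ p⟩

/-- Postcomposition. -/
def helperPost {M N : Type u} [AddCommGroup M] [Module R M] [AddCommGroup N] [Module R N]
    (P : Type u) [AddCommGroup P] [Module R P] (g : M →ₗ[R] N) :
    (P →ₗ[R] M) →ₗ[(Module.End R P)ᵐᵒᵖ] (P →ₗ[R] N) where
  toFun f := g.comp f
  map_add' f f' := by ext; simp
  map_smul' φ f := rfl

lemma helper_length_exact [Module.Projective R P] {M : Type u} [AddCommGroup M] [Module R M]
    (N' N : Submodule R M) (h : N' ≤ N) :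
    Module.length (Module.End R P)ᵐᵒᵖ (P →ₗ[R] N) =
      Module.length (Module.End R P)ᵐᵒᵖ (P →ₗ[R] N') +
      Module.length (Module.End R P)ᵐᵒᵖ (P →ₗ[R] (↥N ⧸ N'.comap N.subtype)) := by
  refine Module.length_eq_add_of_exact (helperPost P (inclusion h)) (helperPost P (mkQ _))
    ?_ ?_ ?_
  · intro f g hfg
    ext p
    have := LinearMap.congr_fun hfg p
    exact congrArg (fun z : N => (z : M)) this
  · intro g
    obtain ⟨f, hf⟩ := Module.projective_lifting_property (mkQ (N'.comap N.subtype)) g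
      (mkQ_surjective _)
    exact ⟨f, hf⟩
  · intro f
    constructor
    · intro hf
      have hm : ∀ p, ((f p : N) : M) ∈ N' := fun p =>
        (Quotient.mk_eq_zero (N'.comap N.subtype)).1 (LinearMap.congr_fun hf p)
      refine ⟨LinearMap.codRestrict N' (N.subtype.comp f) hm, ?_⟩
      ext p
      rfl
    · rintro ⟨g, rfl⟩
      ext p
      exact (Quotient.mk_eq_zero (N'.comap N.subtype)).2 (g p).2

open Classical in
lemma helper_length_simple [Module.Projective R P] (Q : Submodule R P) (hQ' : Q ≠ ⊤)
    (hQ : ∀ N : Submodule R P, N ≠ ⊤ → N ≤ Q)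
    (T : Type u) [AddCommGroup T] [Module R T] [IsSimpleModule R T] :
    Module.length (Module.End R P)ᵐᵒᵖ (P →ₗ[R] T) =
      if Nonempty (T ≃ₗ[R] (P ⧸ Q)) then 1 else 0 := by
  split_ifs with h
  · obtain ⟨i⟩ := h
    rw [Module.length_eq_one_iff, isSimpleModule_iff_toSpanSingleton_surjective]
    constructor
    · refine ⟨(i.symm : (P ⧸ Q) →ₗ[R] T).comp (mkQ Q), 0, ?_⟩
      intro h0
      apply hQ'
      rw [eq_top_iff]
      rintro p -
      have := LinearMap.congr_fun h0 p
      simpa using this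
    · intro g hg f
      have hgs : Function.Surjective g := LinearMap.surjective_of_ne_zero hg
      obtain ⟨φ, hφ⟩ := Module.projective_lifting_property g f hgs
      exact ⟨op φ, hφ⟩
  · rw [Module.length_eq_zero_iff]
    refine subsingleton_of_forall_eq 0 fun g => ?_
    by_contra hg
    apply h
    have hgs : Function.Surjective g := LinearMap.surjective_of_ne_zero hg
    have hk : LinearMap.ker g = Q := by
      have hc : IsCoatom (LinearMap.ker g) := by
        rw [← isSimpleModule_iff_isCoatom]
        exact IsSimpleModule.congr (g.quotKerEquivOfSurjective hgs)
      exact (hc.le_iff_eq hQ').1 (hQ _ hc.1) |>.symm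
    exact ⟨(g.quotKerEquivOfSurjective hgs).symm.trans (quotEquivOfEq _ _ hk)⟩

lemma helper_telescope (n : ℕ) (F : Fin (n + 1) → ℕ∞) (a : Fin n → ℕ∞) (h0 : F 0 = 0)
    (h : ∀ i : Fin n, F i.succ = F i.castSucc + a i) : F (Fin.last n) = ∑ i, a i := by
  induction n with
  | zero => simpa using h0
  | succ n ih =>
    rw [Fin.sum_univ_castSucc, ← Fin.succ_last, h (Fin.last n)]
    congr 1
    exact ih (fun i => F i.castSucc) (fun i => a i.castSucc) h0 (fun i => h i.castSucc)

lemma helper_mult [Module.Projective R P] (Q : Submodule R P) (hQ' : Q ≠ ⊤)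
    (hQ : ∀ N : Submodule R P, N ≠ ⊤ → N ≤ Q)
    (hbij : ∀ φ : Module.End R P, φ ≠ 0 → Function.Bijective φ)
    (M : Type u) [AddCommGroup M] [Module R M] (s : MCompSeries R M) :
    Nat.card {i : Fin s.n // Nonempty (s.factor i ≃ₗ[R] (P ⧸ Q))} =
      Module.finrank (Module.End R P)ᵐᵒᵖ (P →ₗ[R] M) := by
  classical
  have hsimp := s.simple
  have hlast := helper_telescope s.n
    (fun i => Module.length (Module.End R P)ᵐᵒᵖ (P →ₗ[R] s.ser i))
    (fun i => if Nonempty (s.factor i ≃ₗ[R] (P ⧸ Q)) then 1 else 0)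
    (by
      show Module.length (Module.End R P)ᵐᵒᵖ (P →ₗ[R] s.ser 0) = 0
      rw [Module.length_eq_zero_iff, s.bot]
      infer_instance)
    (fun i => by
      have := hsimp i
      rw [← helper_length_simple Q hQ' hQ]
      exact helper_length_exact _ _ (s.strictMono.monotone (Fin.castSucc_lt_succ).le))
  have htop : Module.length (Module.End R P)ᵐᵒᵖ (P →ₗ[R] s.ser (Fin.last s.n)) =
      Module.length (Module.End R P)ᵐᵒᵖ (P →ₗ[R] M) := by
    rw [s.top]
    refine (LinearEquiv.ofBijective (helperPost P (⊤ : Submodule R M).subtype) ⟨?_, ?_⟩).length_eq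
    · intro f g hfg
      ext p
      exact LinearMap.congr_fun hfg p
    · intro f
      exact ⟨LinearMap.codRestrict ⊤ f (fun _ => trivial), rfl⟩
  have hcard : (∑ i : Fin s.n, if Nonempty (s.factor i ≃ₗ[R] (P ⧸ Q)) then (1 : ℕ∞) else 0) =
      (Nat.card {i : Fin s.n // Nonempty (s.factor i ≃ₗ[R] (P ⧸ Q))} : ℕ∞) := by
    rw [Finset.sum_boole, Nat.card_eq_fintype_card, Fintype.card_subtype]
  have hlen : Module.length (Module.End R P)ᵐᵒᵖ (P →ₗ[R] M) =
      (Nat.card {i : Fin s.n // Nonempty (s.factor i ≃ₗ[R] (P ⧸ Q))} : ℕ∞) :=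
    htop.symm.trans (hlast.trans hcard)
  have hnt : Nontrivial P := by
    obtain ⟨p, -, hp⟩ := SetLike.exists_of_lt (lt_top_iff_ne_top.2 hQ')
    exact ⟨p, 0, fun h => hp (h ▸ zero_mem _)⟩
  letI : DivisionRing (Module.End R P)ᵐᵒᵖ := DivisionRing.ofIsUnitOrEqZero fun a => by
    by_cases h : a.unop = 0
    · exact Or.inr (unop_injective h)
    · left
      rw [← isUnit_unop]
      exact (Module.End.isUnit_iff _).2 (hbij _ h)
  have h3 := Module.length_eq_rank (Module.End R P)ᵐᵒᵖ (P →ₗ[R] M)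
  rw [hlen] at h3
  have h4 := congrArg ENat.toNat h3
  rw [ENat.toNat_natCast] at h4
  rw [h4]
  exact Cardinal.toNat_toENat _

end Helpers

section Idem

variable {A}

lemma helper_projective (e : A) (he : IsIdempotentElem e) :
    Module.Projective Aᵐᵒᵖ ↥(Pmod A e) := by
  refine Module.Projective.of_split (Pmod A e).subtype
    (LinearMap.toSpanSingleton Aᵐᵒᵖ ↥(Pmod A e) ⟨op e, Submodule.mem_span_singleton_self _⟩) ?_
  ext ⟨p, hp⟩
  obtain ⟨r, rfl⟩ := Submodule.mem_span_singleton.1 hp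
  show (r • op e) * op e = r • op e
  rw [smul_eq_mul, mul_assoc, ← op_mul, he.eq]

/-- The radical of `eA`. -/
noncomputable def helperQ (e : A) : Submodule Aᵐᵒᵖ ↥(Pmod A e) :=
  Submodule.comap (Pmod A e).subtype (Jrad A)

lemma helper_equiv (e : A) : Nonempty ((↥(Pmod A e) ⧸ helperQ e) ≃ₗ[Aᵐᵒᵖ] ↥(Smod A e)) := by
  let ξ : ↥(Pmod A e) →ₗ[Aᵐᵒᵖ] AoverJ A := (Submodule.mkQ (Jrad A)).comp (Pmod A e).subtype
  have hk : LinearMap.ker ξ = helperQ e := by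
    rw [LinearMap.ker_comp, Submodule.ker_mkQ]; rfl
  have hr : LinearMap.range ξ = Smod A e := by
    rw [LinearMap.range_comp, Submodule.range_subtype, Pmod, Submodule.map_span,
      Set.image_singleton]
    rfl
  exact ⟨(Submodule.quotEquivOfEq _ _ hk.symm).trans
    (ξ.quotKerEquivRange.trans (LinearEquiv.ofEq _ _ hr))⟩

lemma helper_mem_Jrad (a : A) : op a ∈ Jrad A ↔ ∀ y, ∃ z, z * y * a + z - 1 = 0 := by
  rw [Jrad, TwoSidedIdeal.mem_asIdealOpposite, TwoSidedIdeal.mem_jacobson_iff]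
  rfl

lemma helperQ_ne_top (e : A) (he : IsIdempotentElem e) (h0 : e ≠ 0) : helperQ e ≠ ⊤ := by
  intro h
  have h1 : (⟨op e, Submodule.mem_span_singleton_self _⟩ : ↥(Pmod A e)) ∈ helperQ e := by
    rw [h]; trivial
  have h2 : op e ∈ Jrad A := h1
  obtain ⟨z, hz⟩ := (helper_mem_Jrad e).1 h2 (-1)
  apply h0
  have h3 : (z * (-1) * e + z - 1) * e = 0 := by rw [hz, zero_mul]
  have h4 : (z * (-1) * e + z - 1) * e = -(z * (e * e)) + z * e - e := by noncomm_ring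
  rw [h4, he.eq] at h3
  simpa using h3

lemma helper_indec (e : A) (hprim : ∀ f g : A, IsIdempotentElem f → IsIdempotentElem g →
    f * g = 0 → g * f = 0 → f + g = e → f = 0 ∨ g = 0) (he : IsIdempotentElem e)
    (K L : Submodule Aᵐᵒᵖ ↥(Pmod A e)) (hKL : IsCompl K L) : K = ⊤ ∨ L = ⊤ := by
  let f : ↥(Pmod A e) := ⟨op e, Submodule.mem_span_singleton_self _⟩
  have hgen : ∀ p : ↥(Pmod A e), p = (p : Aᵐᵒᵖ) • f := by
    rintro ⟨p, hp⟩
    obtain ⟨r, rfl⟩ := Submodule.mem_span_singleton.1 hp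
    apply Subtype.ext
    show r • op e = (r • op e) * op e
    rw [smul_eq_mul, mul_assoc, ← op_mul, he.eq]
  have htop : ∀ X : Submodule Aᵐᵒᵖ ↥(Pmod A e), f ∈ X → X = ⊤ := by
    intro X hX
    rw [eq_top_iff]
    rintro p -
    rw [hgen p]
    exact X.smul_mem _ hX
  have hf : f ∈ K ⊔ L := by rw [hKL.sup_eq_top]; trivial
  obtain ⟨a, ha, b, hb, hab⟩ := Submodule.mem_sup.1 hf
  have key : ∀ u ∈ K, ∀ v ∈ L, u = v → u = 0 := by
    intro u hu v hv huv
    have : u ∈ K ⊓ L := ⟨hu, huv ▸ hv⟩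
    rw [hKL.inf_eq_bot] at this
    exact this
  have ea : a = (a : Aᵐᵒᵖ) • a + (a : Aᵐᵒᵖ) • b := by rw [← smul_add, hab]; exact hgen a
  have eb : b = (b : Aᵐᵒᵖ) • a + (b : Aᵐᵒᵖ) • b := by rw [← smul_add, hab]; exact hgen b
  have hab0 : (a : Aᵐᵒᵖ) • b = 0 := by
    have h1 : a - (a : Aᵐᵒᵖ) • a = (a : Aᵐᵒᵖ) • b := by
      rw [sub_eq_iff_eq_add, add_comm]; exact ea
    rw [← h1]
    exact key _ (K.sub_mem ha (K.smul_mem _ ha)) _ (L.smul_mem _ hb) h1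
  have hba0 : (b : Aᵐᵒᵖ) • a = 0 := by
    have h1 : (b : Aᵐᵒᵖ) • a = b - (b : Aᵐᵒᵖ) • b := by
      rw [eq_sub_iff_add_eq]; exact eb.symm
    exact key _ (K.smul_mem _ ha) _ (L.sub_mem hb (L.smul_mem _ hb)) h1
  rw [hab0, add_zero] at ea
  rw [hba0, zero_add] at eb
  have ea' : (a : Aᵐᵒᵖ) = (a : Aᵐᵒᵖ) * a := congrArg Subtype.val ea
  have eb' : (b : Aᵐᵒᵖ) = (b : Aᵐᵒᵖ) * b := congrArg Subtype.val eb
  have hab' : (a : Aᵐᵒᵖ) * b = 0 := congrArg Subtype.val hab0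
  have hba' : (b : Aᵐᵒᵖ) * a = 0 := congrArg Subtype.val hba0
  have hsum : (a : Aᵐᵒᵖ) + b = op e := congrArg Subtype.val hab
  rcases hprim (unop (a : Aᵐᵒᵖ)) (unop (b : Aᵐᵒᵖ)) (congrArg unop ea').symm
    (congrArg unop eb').symm (congrArg unop hba') (congrArg unop hab') (congrArg unop hsum)
    with h | h
  · right
    have : a = 0 := Subtype.ext (unop_injective h)
    rw [this, zero_add] at hab
    exact htop L (hab ▸ hb)
  · left
    have : b = 0 := Subtype.ext (unop_injective h)
    rw [this, add_zero] at hab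
    exact htop K (hab ▸ ha)

lemma helperQ_max [IsArtinianRing Aᵐᵒᵖ] (e : A)
    (hprim : ∀ f g : A, IsIdempotentElem f → IsIdempotentElem g →
    f * g = 0 → g * f = 0 → f + g = e → f = 0 ∨ g = 0) (he : IsIdempotentElem e)
    (N : Submodule Aᵐᵒᵖ ↥(Pmod A e)) (hN : N ≠ ⊤) : N ≤ helperQ e := by
  have hfix : ∀ p : ↥(Pmod A e), (p : Aᵐᵒᵖ) * op e = p := by
    rintro ⟨p, hp⟩
    obtain ⟨r, rfl⟩ := Submodule.mem_span_singleton.1 hp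
    show (r • op e) * op e = r • op e
    rw [smul_eq_mul, mul_assoc, ← op_mul, he.eq]
  have hnil : ∀ m ∈ N, IsNilpotent (m : Aᵐᵒᵖ) := by
    intro m hm
    let φ : Module.End Aᵐᵒᵖ ↥(Pmod A e) :=
      (LinearMap.toSpanSingleton Aᵐᵒᵖ ↥(Pmod A e) m).comp (Pmod A e).subtype
    have hφ : ∀ p, φ p = (p : Aᵐᵒᵖ) • m := fun p => rfl
    obtain ⟨k, hk⟩ := Filter.eventually_atTop.1 φ.eventually_isCompl_ker_pow_range_pow
    have hk := hk (k + 1) (by omega)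
    have hpow : ∀ (j : ℕ) (p : ↥(Pmod A e)),
        (((φ ^ j) p : ↥(Pmod A e)) : Aᵐᵒᵖ) = (p : Aᵐᵒᵖ) * (m : Aᵐᵒᵖ) ^ j := by
      intro j
      induction j with
      | zero => intro p; simp
      | succ j ih =>
        intro p
        rw [pow_succ, Module.End.mul_apply, ih, hφ, pow_succ', ← mul_assoc]
        rfl
    rcases helper_indec e hprim he _ _ hk with h | h
    · refine ⟨k + 2, ?_⟩
      have h1 : m ∈ LinearMap.ker (φ ^ (k + 1)) := by rw [h]; trivial
      have h2 := hpow (k + 1) m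
      rw [LinearMap.mem_ker.1 h1] at h2
      rw [pow_succ', ← h2]
      rfl
    · exfalso
      apply hN
      rw [eq_top_iff, ← h]
      rintro _ ⟨p, rfl⟩
      rw [pow_succ', Module.End.mul_apply, hφ]
      exact N.smul_mem _ hm
  intro n hn
  show (n : Aᵐᵒᵖ) ∈ Jrad A
  obtain ⟨a, ha⟩ : ∃ a : A, (n : Aᵐᵒᵖ) = op a := ⟨unop (n : Aᵐᵒᵖ), rfl⟩
  rw [ha, helper_mem_Jrad]
  intro y
  obtain ⟨k, hk⟩ := hnil (op y • n) (N.smul_mem _ hn)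
  have hk' : (a * y) ^ k = 0 := by
    have h1 : (op (a * y)) ^ k = 0 := by
      rw [← hk, op_mul, ← ha]; rfl
    exact op_injective (by rw [op_pow, h1]; rfl)
  have hya : IsNilpotent (y * a) := by
    refine ⟨k + 1, ?_⟩
    have h1 : (y * a) ^ (k + 1) = y * (a * y) ^ k * a := by
      clear hk hk'
      induction k with
      | zero => simp
      | succ k ih => rw [pow_succ, ih, pow_succ (a * y)]; simp only [mul_assoc]
    rw [h1, hk']; simp
  obtain ⟨u, hu⟩ := hya.isUnit_one_add
  refine ⟨(↑u⁻¹ : A), ?_⟩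
  have : (↑u⁻¹ : A) * (1 + y * a) = 1 := by rw [← hu]; exact u.inv_mul
  rw [← this]
  noncomm_ring

end Idem

/-- Let `A` be a basic right artinian ring whose ext-quiver of `mod A` is acyclic, with a
complete set of primitive orthogonal idempotents `e_x` and simple right modules
`S_x = e_x(A/J)`.  Then `End_A(e_x A) ≅ E_x = End_A(S_x)` for each `x`, and for every
right `A`-module `M` of finite length the multiplicity of `S_x` in a composition series of
`M` equals `dim_{E_x} Hom_A(e_x A, M)`. -/
theorem end_iso_and_multiplicity_eq_dim_hom
    [IsArtinianRing Aᵐᵒᵖ]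
    (P : Type u) [Fintype P] (e : P → A) (hsys : IdempotentSystem A P e)
    (hbasic : ∀ x y, x ≠ y → ¬ Nonempty (↥(Smod A (e x)) ≃ₗ[Aᵐᵒᵖ] ↥(Smod A (e y))))
    (hacyc : MExtQuiverAcyclic Aᵐᵒᵖ) (x : P) :
    Nonempty ((Module.End Aᵐᵒᵖ ↥(Pmod A (e x))) ≃+* (Module.End Aᵐᵒᵖ ↥(Smod A (e x)))) ∧
      ∀ (M : Type u) [AddCommGroup M] [Module Aᵐᵒᵖ M] (s : MCompSeries Aᵐᵒᵖ M),
        Nat.card {i : Fin s.n // Nonempty (s.factor i ≃ₗ[Aᵐᵒᵖ] ↥(Smod A (e x)))} =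
          Module.finrank (Module.End Aᵐᵒᵖ ↥(Pmod A (e x)))ᵐᵒᵖ
            (↥(Pmod A (e x)) →ₗ[Aᵐᵒᵖ] M) := by
  have he := hsys.idem x
  have hprim := hsys.primitive x
  haveI := helper_projective (e x) he
  have hQ' := helperQ_ne_top (e x) he (hsys.ne_zero x)
  have hQ := helperQ_max (e x) hprim he
  have hbij := helper_unit (helperQ (e x)) hQ' hQ hacyc
  obtain ⟨i⟩ := helper_equiv (e x)
  refine ⟨?_, ?_⟩
  · obtain ⟨F⟩ := helper_endIso (helperQ (e x)) hQ' hQ hbij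
    exact ⟨F.trans i.conjRingEquiv⟩
  · intro M _ _ s
    rw [← helper_mult (helperQ (e x)) hQ' hQ hbij M s]
    exact Nat.card_congr (Equiv.subtypeEquivRight fun j =>
      ⟨fun ⟨k⟩ => ⟨k.trans i.symm⟩, fun ⟨k⟩ => ⟨k.trans i⟩⟩)
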